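/- arXiv:1806.04910 — 3 statements merged into one kernel-verified Lean document; each statement's English description precedes it below -/
import Mathlib

section
/- Let Λ ⊆ ℝ^m be a nonempty compact set, let E : ℝ^d × ℝ^m → ℝ be jointly continuous, and let L : ℝ^d × ℝ^m → ℝ be jointly continuous such that for every λ ∈ Λ the function w ↦ L(w, λ) has a unique global minimizer w_λ over ℝ^d, and the map λ ↦ w_λ is bounded on Λ (its image is contained in some ball). Then the function f : Λ → ℝ defined by f(λ) = E(w_λ, λ) attains its minimum on Λ; that is, there exists λ* ∈ Λ such that f(λ*) ≤ f(λ) for all λ ∈ Λ. -/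
open Filter Topology

/-- Existence theorem for the bilevel problem: the outer objective
`f(λ) = E(w_λ, λ)` attains its minimum on the compact set `Λ`. -/
theorem bilevel_existence {d m : ℕ}
    (S : Set (EuclideanSpace ℝ (Fin m))) (hS : S.Nonempty) (hScomp : IsCompact S)
    (E : EuclideanSpace ℝ (Fin d) × EuclideanSpace ℝ (Fin m) → ℝ) (hE : Continuous E)
    (L : EuclideanSpace ℝ (Fin d) × EuclideanSpace ℝ (Fin m) → ℝ) (hL : Continuous L)
    (w : EuclideanSpace ℝ (Fin m) → EuclideanSpace ℝ (Fin d))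
    (hmin : ∀ lam ∈ S, ∀ u, L (w lam, lam) ≤ L (u, lam))
    (huniq : ∀ lam ∈ S, ∀ u, (∀ v, L (u, lam) ≤ L (v, lam)) → u = w lam)
    (hbd : ∃ C : ℝ, ∀ lam ∈ S, ‖w lam‖ ≤ C) :
    ∃ lamstar ∈ S, ∀ lam ∈ S, E (w lamstar, lamstar) ≤ E (w lam, lam) := by
  obtain ⟨C, hC⟩ := hbd
  have hclosed : IsClosed {p : EuclideanSpace ℝ (Fin d) × EuclideanSpace ℝ (Fin m) |
      ∀ v, L p ≤ L (v, p.2)} := by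
    rw [Set.setOf_forall]
    exact isClosed_iInter fun v => isClosed_le hL (by fun_prop)
  have hK := ((isCompact_closedBall (0 : EuclideanSpace ℝ (Fin d)) C).prod hScomp).inter_right
    hclosed
  have hmem : ∀ lam ∈ S, (w lam, lam) ∈ (Metric.closedBall (0 : EuclideanSpace ℝ (Fin d)) C ×ˢ S) ∩
      {p : EuclideanSpace ℝ (Fin d) × EuclideanSpace ℝ (Fin m) | ∀ v, L p ≤ L (v, p.2)} := by
    intro lam h
    exact ⟨⟨mem_closedBall_zero_iff.2 (hC lam h), h⟩, hmin lam h⟩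
  obtain ⟨l0, hl0⟩ := hS
  obtain ⟨⟨u, l⟩, ⟨⟨_, hl⟩, hu⟩, hm⟩ := hK.exists_isMinOn ⟨_, hmem l0 hl0⟩ hE.continuousOn
  have hul : u = w l := huniq l hl u hu
  subst hul
  exact ⟨l, hl, fun lam h => hm (hmem lam h)⟩
end

section
/- Let Λ ⊆ ℝ^m be a nonempty compact set. Let E : ℝ^d × ℝ^m → ℝ be jointly continuous and such that, for some ν ≥ 0, the function w ↦ E(w, λ) is ν-Lipschitz continuous on ℝ^d for every λ ∈ Λ. Let L : ℝ^d × ℝ^m → ℝ be jointly continuous such that for every λ ∈ Λ the function w ↦ L(w, λ) has a unique global minimizer w_λ, with λ ↦ w_λ bounded on Λ. For each T ∈ ℕ let w_T : Λ → ℝ^d be continuous, and suppose w_T converges uniformly on Λ to the map λ ↦ w_λ as T → ∞. Define f_T(λ) = E(w_T(λ), λ) and f(λ) = E(w_λ, λ). Then inf_{λ∈Λ} f_T(λ) → inf_{λ∈Λ} f(λ) as T → ∞. -/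
open Filter Topology

/-- Convergence Theorem, part (a): the infima of the approximate outer
objectives converge to the infimum of the exact outer objective. -/
theorem bilevel_convergence_inf {d m : ℕ}
    (S : Set (EuclideanSpace ℝ (Fin m))) (hS : S.Nonempty) (hScomp : IsCompact S)
    (E : EuclideanSpace ℝ (Fin d) × EuclideanSpace ℝ (Fin m) → ℝ) (hE : Continuous E)
    (ν : ℝ) (hν : 0 ≤ ν)
    (hlip : ∀ lam ∈ S, ∀ u v : EuclideanSpace ℝ (Fin d),
      |E (u, lam) - E (v, lam)| ≤ ν * ‖u - v‖)
    (L : EuclideanSpace ℝ (Fin d) × EuclideanSpace ℝ (Fin m) → ℝ) (hL : Continuous L)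
    (w : EuclideanSpace ℝ (Fin m) → EuclideanSpace ℝ (Fin d))
    (hmin : ∀ lam ∈ S, ∀ u, L (w lam, lam) ≤ L (u, lam))
    (huniq : ∀ lam ∈ S, ∀ u, (∀ v, L (u, lam) ≤ L (v, lam)) → u = w lam)
    (hbd : ∃ C : ℝ, ∀ lam ∈ S, ‖w lam‖ ≤ C)
    (wT : ℕ → EuclideanSpace ℝ (Fin m) → EuclideanSpace ℝ (Fin d))
    (hwT : ∀ T, Continuous (wT T))
    (hconv : TendstoUniformlyOn wT w atTop S) :
    Tendsto (fun T => sInf ((fun lam => E (wT T lam, lam)) '' S)) atTop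
      (𝓝 (sInf ((fun lam => E (w lam, lam)) '' S))) := by
  have hw : ContinuousOn w S :=
    hconv.continuousOn (Frequently.of_forall fun T => (hwT T).continuousOn)
  have hb : BddBelow ((fun lam => E (w lam, lam)) '' S) :=
    hScomp.bddBelow_image (hE.comp_continuousOn (hw.prodMk continuousOn_id))
  have hbT : ∀ T, BddBelow ((fun lam => E (wT T lam, lam)) '' S) := fun T =>
    hScomp.bddBelow_image (hE.comp_continuousOn ((hwT T).continuousOn.prodMk continuousOn_id))
  rw [Metric.tendsto_atTop']
  intro ε hε
  have hδ : 0 < ε / (2 * (ν + 1)) := by positivity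
  obtain ⟨N, hN⟩ := eventually_atTop.1 (Metric.tendstoUniformlyOn_iff.1 hconv _ hδ)
  refine ⟨N, fun T hT => ?_⟩
  have key : ∀ lam ∈ S, |E (wT T lam, lam) - E (w lam, lam)| ≤ ε / 2 := by
    intro lam hl
    have h1 := hlip lam hl (wT T lam) (w lam)
    have h2 := hN T hT.le lam hl
    rw [dist_comm, dist_eq_norm] at h2
    have h3 : ν * ‖wT T lam - w lam‖ ≤ (ν + 1) * (ε / (2 * (ν + 1))) := by
      gcongr
      linarith
    have h4 : (ν + 1) * (ε / (2 * (ν + 1))) = ε / 2 := by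
      field_simp
    linarith
  have A : sInf ((fun lam => E (w lam, lam)) '' S) - ε / 2
      ≤ sInf ((fun lam => E (wT T lam, lam)) '' S) := by
    refine le_csInf (hS.image _) ?_
    rintro _ ⟨lam, hl, rfl⟩
    have h1 := csInf_le hb ⟨lam, hl, rfl⟩
    have h2 := abs_le.1 (key lam hl)
    dsimp only at h1 ⊢
    linarith [h2.1]
  have B : sInf ((fun lam => E (wT T lam, lam)) '' S) - ε / 2
      ≤ sInf ((fun lam => E (w lam, lam)) '' S) := by
    refine le_csInf (hS.image _) ?_
    rintro _ ⟨lam, hl, rfl⟩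
    have h1 := csInf_le (hbT T) ⟨lam, hl, rfl⟩
    have h2 := abs_le.1 (key lam hl)
    dsimp only at h1 ⊢
    linarith [h2.2]
  rw [Real.dist_eq, abs_lt]
  constructor <;> linarith
end

section
/- Let Λ ⊆ ℝ^m be a nonempty compact set. Let E : ℝ^d × ℝ^m → ℝ be jointly continuous and such that, for some ν ≥ 0, the function w ↦ E(w, λ) is ν-Lipschitz continuous on ℝ^d for every λ ∈ Λ. Let L : ℝ^d × ℝ^m → ℝ be jointly continuous such that for every λ ∈ Λ the function w ↦ L(w, λ) has a unique global minimizer w_λ, with λ ↦ w_λ bounded on Λ. For each T ∈ ℕ let w_T : Λ → ℝ^d be continuous, and suppose w_T converges uniformly on Λ to the map λ ↦ w_λ as T → ∞. Define f_T(λ) = E(w_T(λ), λ) and f(λ) = E(w_λ, λ). For each T, let λ_T ∈ Λ be a global minimizer of f_T on Λ. Then (λ_T) admits a convergent subsequence, and every subsequence (λ_{K_T}) with λ_{K_T} → λ̄ ∈ Λ satisfies that λ̄ is a global minimizer of f on Λ. -/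
open Filter Topology

/-- Convergence Theorem, part (b): minimizers of the approximate outer
objectives admit convergent subsequences, and every cluster point minimizes
the exact outer objective. -/
theorem bilevel_convergence_argmin {d m : ℕ}
    (S : Set (EuclideanSpace ℝ (Fin m))) (hS : S.Nonempty) (hScomp : IsCompact S)
    (E : EuclideanSpace ℝ (Fin d) × EuclideanSpace ℝ (Fin m) → ℝ) (hE : Continuous E)
    (ν : ℝ) (hν : 0 ≤ ν)
    (hlip : ∀ lam ∈ S, ∀ u v : EuclideanSpace ℝ (Fin d),
      |E (u, lam) - E (v, lam)| ≤ ν * ‖u - v‖)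
    (L : EuclideanSpace ℝ (Fin d) × EuclideanSpace ℝ (Fin m) → ℝ) (hL : Continuous L)
    (w : EuclideanSpace ℝ (Fin m) → EuclideanSpace ℝ (Fin d))
    (hmin : ∀ lam ∈ S, ∀ u, L (w lam, lam) ≤ L (u, lam))
    (huniq : ∀ lam ∈ S, ∀ u, (∀ v, L (u, lam) ≤ L (v, lam)) → u = w lam)
    (hbd : ∃ C : ℝ, ∀ lam ∈ S, ‖w lam‖ ≤ C)
    (wT : ℕ → EuclideanSpace ℝ (Fin m) → EuclideanSpace ℝ (Fin d))
    (hwT : ∀ T, Continuous (wT T))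
    (hconv : TendstoUniformlyOn wT w atTop S)
    (lseq : ℕ → EuclideanSpace ℝ (Fin m)) (hlseqS : ∀ T, lseq T ∈ S)
    (hlseqmin : ∀ T, ∀ lam ∈ S, E (wT T (lseq T), lseq T) ≤ E (wT T lam, lam)) :
    (∃ K : ℕ → ℕ, StrictMono K ∧ ∃ lbar ∈ S,
        Tendsto (fun T => lseq (K T)) atTop (𝓝 lbar)) ∧
    ∀ (K : ℕ → ℕ), StrictMono K → ∀ lbar ∈ S,
      Tendsto (fun T => lseq (K T)) atTop (𝓝 lbar) →
      ∀ lam ∈ S, E (w lbar, lbar) ≤ E (w lam, lam) := by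
  have hwc : ContinuousOn w S :=
    hconv.continuousOn (Frequently.of_forall fun T => (hwT T).continuousOn)
  refine ⟨?_, ?_⟩
  · obtain ⟨l, hl, K, hK, hlim⟩ := hScomp.tendsto_subseq hlseqS
    exact ⟨K, hK, l, hl, hlim⟩
  · intro K hK lbar hlbar hlim lam hlam
    have hu : TendstoUniformlyOn (fun T => wT (K T)) w atTop S :=
      fun u hu => hK.tendsto_atTop.eventually (hconv u hu)
    have hlim' : Tendsto (fun T => lseq (K T)) atTop (𝓝[S] lbar) :=
      tendsto_nhdsWithin_iff.2 ⟨hlim, Eventually.of_forall fun T => hlseqS _⟩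
    have h1 : Tendsto (fun T => wT (K T) (lseq (K T))) atTop (𝓝 (w lbar)) :=
      tendsto_comp_of_locally_uniform_limit_within (hwc lbar hlbar) hlim'
        (fun u hu' => ⟨S, self_mem_nhdsWithin, hu u hu'⟩)
    have h2 : Tendsto (fun T => wT (K T) lam) atTop (𝓝 (w lam)) := hu.tendsto_at hlam
    have h3 := (hE.tendsto (w lbar, lbar)).comp (h1.prodMk_nhds hlim)
    have h4 := (hE.tendsto (w lam, lam)).comp (h2.prodMk_nhds tendsto_const_nhds)
    exact le_of_tendsto_of_tendsto' h3 h4 fun T => hlseqmin (K T) lam hlam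
end
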